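/- arXiv:2512.05480 — 3 statements merged into one kernel-verified Lean document; each statement's English description precedes it below -/
import Mathlib

section
/- Let n ≥ 2 be an odd integer and let a, b be integers with 0 < a < b < n. If a and b have the same parity (both even or both odd), then the 5-regular circulant graph C_{2n}(a,b,n) is word-representable. -/
/-- Two letters `x` and `y` alternate in the word `w` if, after deleting all letters
other than `x` and `y`, no two consecutive letters of the resulting word are equal. -/
def Alternate {V : Type*} [DecidableEq V] (w : List V) (x y : V) : Prop :=
  (w.filter (fun z => decide (z = x ∨ z = y))).Chain' (· ≠ ·)

/-- A word `w` represents the graph `G` if it contains every vertex at least once and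
two distinct vertices are adjacent in `G` iff they alternate in `w`. -/
def Represents {V : Type*} [DecidableEq V] (G : SimpleGraph V) (w : List V) : Prop :=
  (∀ v : V, v ∈ w) ∧ ∀ x y : V, x ≠ y → (G.Adj x y ↔ Alternate w x y)

/-- A graph is word-representable if some word represents it. -/
def WordRepresentable {V : Type*} [DecidableEq V] (G : SimpleGraph V) : Prop :=
  ∃ w : List V, Represents G w

/-- A word is `k`-uniform if every letter of the alphabet occurs in it exactly `k` times. -/
def IsKUniform {V : Type*} [DecidableEq V] (w : List V) (k : ℕ) : Prop :=
  ∀ v : V, w.count v = k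

theorem filter_pair_of_nodup {V : Type*} [DecidableEq V] {L : List V} (hnd : L.Nodup)
    (hmem : ∀ v, v ∈ L) {x y : V} (hxy : x ≠ y) :
    L.filter (fun z => decide (z = x ∨ z = y)) = [x, y] ∨
      L.filter (fun z => decide (z = x ∨ z = y)) = [y, x] := by
  have hp : (L.filter (fun z => decide (z = x ∨ z = y))).Perm [x, y] := by
    rw [List.perm_ext_iff_of_nodup (hnd.filter _) (by simp [hxy])]
    intro z
    simp [hmem z]
  exact List.perm_pair.mp hp

/-- The edges of `G`, oriented towards the larger value of `h`. -/
def orientedEdge {V : Type*} (G : SimpleGraph V) (h : V → ℕ) (x y : V) : Prop :=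
  G.Adj x y ∧ h x < h y

open Classical in
/-- The position of `u` relative to `v` in the orientation by `h`: `0` for a non-adjacent
ancestor, `1` for an in-neighbour, `2` for an incomparable vertex, `3` for `v` itself,
`4` for an out-neighbour and `5` for a non-adjacent descendant. -/
noncomputable def relativePosition {V : Type*} (G : SimpleGraph V) (h : V → ℕ) (v u : V) : ℕ :=
  if u = v then 3
  else if G.Adj u v then (if h u < h v then 1 else 4)
  else if Relation.TransGen (orientedEdge G h) u v then 0
  else if Relation.TransGen (orientedEdge G h) v u then 5
  else 2

/-- The word listing, for each label of the pattern `0 1 2 0 3 4 1 3 5 2 4 5` in turn, the letters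
of `L` carrying that label. -/
def patternWord {V : Type*} (c : V → ℕ) (L : List V) : List V :=
  [0, 1, 2, 0, 3, 4, 1, 3, 5, 2, 4, 5].flatMap fun i => L.filter fun z => decide (c z = i)

theorem patternWord_filter {V : Type*} (c : V → ℕ) (L : List V) (p : V → Bool) :
    (patternWord c L).filter p = patternWord c (L.filter p) := by
  simp only [patternWord, List.filter_flatMap]
  congr 1
  funext i
  exact List.filter_comm _ _ _

theorem isChain_flatMap_const {V W : Type*} {x y : V} (hxy : x ≠ y) (l : List W) :
    (l.flatMap fun _ => [x, y, x, y]).IsChain (· ≠ ·) ∧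
      ∀ z ∈ (l.flatMap fun _ => [x, y, x, y]).head?, z = x := by
  induction l with
  | nil => simp
  | cons _ l ih =>
    refine ⟨?_, by simp⟩
    rw [List.flatMap_cons, List.isChain_append]
    refine ⟨by simp [hxy, hxy.symm], ih.1, ?_⟩
    intro z hz t ht
    have := ih.2 t ht
    simp at hz
    subst this hz
    exact hxy.symm

theorem patternWord_pair_of_edge {V : Type*} {G : SimpleGraph V} {h : V → ℕ}
    (hne : ∀ x y, G.Adj x y → h x ≠ h y)
    (hst : ∀ u v w, Relation.TransGen (orientedEdge G h) u v →
      Relation.TransGen (orientedEdge G h) v w → G.Adj u w → G.Adj u v ∧ G.Adj v w)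
    {x y : V} (hxy : orientedEdge G h x y) (v : V) :
    patternWord (relativePosition G h v) [x, y] = [x, y, x, y] := by
  have key : (relativePosition G h v x, relativePosition G h v y) ∈
      ([(0,0),(0,1),(0,2),(1,1),(1,2),(1,3),(1,4),(3,4),(4,4),(4,5),(2,2),(2,4),(2,5),(5,5)] :
        List (ℕ × ℕ)) := by
    unfold relativePosition
    have e1 : Relation.TransGen (orientedEdge G h) x y := .single hxy
    have mono : ∀ {s t}, Relation.TransGen (orientedEdge G h) s t → h s < h t := by
      intro s t hs
      induction hs with
      | single e => exact e.2
      | tail _ e ih => exact ih.trans e.2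
    have e2 := fun (hv : Relation.TransGen (orientedEdge G h) x v)
      (hw : Relation.TransGen (orientedEdge G h) v y) => hst x v y hv hw hxy.1
    have e3 : Relation.TransGen (orientedEdge G h) y v →
      Relation.TransGen (orientedEdge G h) x v := fun t => e1.trans t
    have e4 : Relation.TransGen (orientedEdge G h) v x →
      Relation.TransGen (orientedEdge G h) v y := fun t => t.trans e1
    have sx : G.Adj x v → h x < h v → Relation.TransGen (orientedEdge G h) x v :=
      fun p q => .single ⟨p, q⟩
    have sy : G.Adj y v → h y < h v → Relation.TransGen (orientedEdge G h) y v :=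
      fun p q => .single ⟨p, q⟩
    have e5 := fun (ht : Relation.TransGen (orientedEdge G h) y v) (hs : G.Adj x v) =>
      (hst x y v e1 ht hs).2
    have e6 := fun (ht : Relation.TransGen (orientedEdge G h) v x) (hs : G.Adj v y) =>
      (hst v x y ht e1 hs).1
    have cxv := G.adj_comm v x
    have mxv := mono (s := x) (t := v)
    have mvx := mono (s := v) (t := x)
    have myv := mono (s := y) (t := v)
    have mvy := mono (s := v) (t := y)
    have svx : G.Adj x v → h v < h x → Relation.TransGen (orientedEdge G h) v x :=
      fun p q => .single ⟨p.symm, q⟩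
    have svy : G.Adj y v → h v < h y → Relation.TransGen (orientedEdge G h) v y :=
      fun p q => .single ⟨p.symm, q⟩
    have nx := hne x v
    have ny := hne y v
    have cyv := G.adj_comm v y
    have hlt := hxy.2
    have hadj := hxy.1
    have hadj' := hxy.1.symm
    clear mono hst
    generalize Relation.TransGen (orientedEdge G h) x v = Rxv at *
    generalize Relation.TransGen (orientedEdge G h) y v = Ryv at *
    generalize Relation.TransGen (orientedEdge G h) v x = Rvx at *
    generalize Relation.TransGen (orientedEdge G h) v y = Rvy at *
    clear e1 hxy
    by_cases hxv : x = v
    · subst hxv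
      have : y ≠ x := hadj'.ne
      simp [this, hadj', hlt.not_gt]
    by_cases hyv : y = v
    · subst hyv
      simp [hxv, hadj, hlt]
    simp only [hxv, hyv, if_false]
    split_ifs <;> first | simp; done | (exfalso; grind)
  simp only [List.mem_cons, Prod.mk.injEq, List.not_mem_nil, or_false] at key
  rcases key with h | h | h | h | h | h | h | h | h | h | h | h | h | h <;>
    simp [patternWord, List.filter_cons, h.1, h.2]

theorem not_isChain_patternWord_pair {V : Type*} {G : SimpleGraph V} {h : V → ℕ} {v u : V}
    (huv : u ≠ v) (hadj : ¬ G.Adj u v) :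
    ¬ (patternWord (relativePosition G h v) [v, u]).IsChain (· ≠ ·) ∧
      ¬ (patternWord (relativePosition G h v) [u, v]).IsChain (· ≠ ·) := by
  have hv : relativePosition G h v v = 3 := by simp [relativePosition]
  have hu : relativePosition G h v u = 0 ∨ relativePosition G h v u = 5 ∨
      relativePosition G h v u = 2 := by
    simp only [relativePosition, huv, hadj, if_false]
    split_ifs <;> simp
  rcases hu with hu | hu | hu <;> simp [patternWord, List.filter_cons, hu, hv]

/-- A finite graph with a semi-transitive orientation is word-representable. -/
theorem wordRepresentable_of_semiTransitive {V : Type*} [DecidableEq V] [Fintype V]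
    (G : SimpleGraph V) (h : V → ℕ) (hne : ∀ x y, G.Adj x y → h x ≠ h y)
    (hst : ∀ u v w, Relation.TransGen (orientedEdge G h) u v →
      Relation.TransGen (orientedEdge G h) v w → G.Adj u w → G.Adj u v ∧ G.Adj v w) :
    WordRepresentable G := by
  set L := (Finset.univ : Finset V).toList.insertionSort (fun x y => h x ≤ h y) with hL
  have hmem : ∀ v, v ∈ L := fun v => by simp [hL]
  have hnd : L.Nodup := (List.perm_insertionSort _ _).nodup_iff.mpr (Finset.nodup_toList _)
  have hsort : L.Pairwise (fun x y => h x ≤ h y) := by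
    have : Std.Total (fun x y : V => h x ≤ h y) := ⟨fun x y => le_total _ _⟩
    have : IsTrans V (fun x y : V => h x ≤ h y) := ⟨fun x y z => le_trans⟩
    exact List.pairwise_insertionSort _ _
  have hfilter : ∀ x y, (L.flatMap fun v => patternWord (relativePosition G h v) L).filter
      (fun z => decide (z = x ∨ z = y)) = L.flatMap fun v =>
        patternWord (relativePosition G h v) (L.filter (fun z => decide (z = x ∨ z = y))) := by
    intro x y
    simp only [List.filter_flatMap, patternWord_filter]
  have hedge : ∀ x y, orientedEdge G h x y →
      (L.flatMap fun v => patternWord (relativePosition G h v)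
        (L.filter (fun z => decide (z = x ∨ z = y)))).IsChain (· ≠ ·) := by
    intro x y hxy
    have hL2 : L.filter (fun z => decide (z = x ∨ z = y)) = [x, y] := by
      rcases filter_pair_of_nodup hnd hmem hxy.1.ne with h1 | h1
      · exact h1
      · have := hsort.filter (fun z => decide (z = x ∨ z = y))
        rw [h1] at this
        have h2 := hxy.2
        simp at this
        omega
    simp only [hL2, patternWord_pair_of_edge hne hst hxy]
    exact (isChain_flatMap_const hxy.1.ne L).1
  refine ⟨L.flatMap fun v => patternWord (relativePosition G h v) L, ?_, ?_⟩
  · intro v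
    refine List.mem_flatMap.mpr ⟨v, hmem v, ?_⟩
    refine List.mem_flatMap.mpr ⟨3, by simp, ?_⟩
    simp [hmem v, relativePosition]
  · intro x y hxy
    unfold Alternate List.Chain'
    rw [hfilter]
    constructor
    · intro hadj
      rcases lt_or_gt_of_ne (hne x y hadj) with h1 | h1
      · exact hedge x y ⟨hadj, h1⟩
      · have := hedge y x ⟨hadj.symm, h1⟩
        simpa only [or_comm] using this
    · intro hch
      by_contra hadj
      have hinf : (patternWord (relativePosition G h x)
          (L.filter (fun z => decide (z = x ∨ z = y)))).IsChain (· ≠ ·) := by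
        refine hch.infix ?_
        exact List.infix_flatMap_of_mem (hmem x) (fun v => patternWord (relativePosition G h v)
          (L.filter (fun z => decide (z = x ∨ z = y))))
      have hno := not_isChain_patternWord_pair (h := h) hxy.symm (fun e => hadj e.symm)
      rcases filter_pair_of_nodup hnd hmem hxy with h1 | h1 <;> rw [h1] at hinf
      · exact hno.1 hinf
      · exact hno.2 hinf

/-- `x` lies strictly within a quarter of `n` of a multiple of `n`. -/
def NearMultiple (n x : ℤ) : Prop := ∃ t : ℤ, -n < 4 * (x - t * n) ∧ 4 * (x - t * n) < n

/-- `x` lies farther than a quarter of `n` from every multiple of `n`. -/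
def FarFromMultiples (n x : ℤ) : Prop := ∃ t : ℤ, n < 4 * (x - t * n) ∧ 4 * (x - t * n) < 3 * n

theorem nearMultiple_of_not_far {n x : ℤ} (hn : 0 < n) (hodd : n % 2 = 1)
    (h : ¬ FarFromMultiples n x) : NearMultiple n x := by
  have h0 := Int.emod_nonneg x hn.ne'
  have h1 := Int.emod_lt_of_pos x hn
  have h2 := Int.mul_ediv_add_emod x n
  have e : x - x / n * n = x % n := by linarith [mul_comm n (x / n)]
  by_cases c1 : 4 * (x % n) < n
  · exact ⟨x / n, by rw [e]; omega, by rw [e]; omega⟩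
  · by_cases c2 : 4 * (x % n) < 3 * n
    · exact absurd ⟨x / n, by rw [e]; omega, by rw [e]; omega⟩ h
    · have e' : x - (x / n + 1) * n = x % n - n := by linarith
      exact ⟨x / n + 1, by rw [e']; omega, by rw [e']; omega⟩

theorem NearMultiple.of_dvd_sub {n x y : ℤ} (h : NearMultiple n x) (hxy : n ∣ x - y) :
    NearMultiple n y := by
  obtain ⟨t, h1, h2⟩ := h
  obtain ⟨s, hs⟩ := hxy
  exact ⟨t - s, by linarith, by linarith⟩

theorem FarFromMultiples.of_dvd_sub {n x y : ℤ} (h : FarFromMultiples n x) (hxy : n ∣ x - y) :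
    FarFromMultiples n y := by
  obtain ⟨t, h1, h2⟩ := h
  obtain ⟨s, hs⟩ := hxy
  exact ⟨t - s, by linarith, by linarith⟩

theorem FarFromMultiples.mul_left {n x d : ℤ} (hd : 0 < d) (h : FarFromMultiples n x) :
    FarFromMultiples (d * n) (d * x) := by
  obtain ⟨t, h1, h2⟩ := h
  exact ⟨t, by nlinarith, by nlinarith⟩

/-- An arithmetic progression of small step cannot jump over the residues far from the multiples
of `n`, so it stays near multiples only for a short time. -/
theorem length_mul_step_lt {n x y : ℤ} (hy : 0 < y) (hyn : 2 * y < n) (N : ℕ)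
    (h : ∀ j : ℕ, j ≤ N → NearMultiple n (x + j * y)) : 2 * (N * y) < n := by
  obtain ⟨t, ht1, ht2⟩ := h 0 (Nat.zero_le _)
  have key : ∀ j : ℕ, j ≤ N →
      -n < 4 * (x + j * y - t * n) ∧ 4 * (x + j * y - t * n) < n := by
    intro j
    induction j with
    | zero => exact fun _ => ⟨ht1, ht2⟩
    | succ j ih =>
      intro hj
      obtain ⟨i1, i2⟩ := ih (by omega)
      obtain ⟨s, s1, s2⟩ := h (j + 1) hj
      push_cast at s1 s2 ⊢
      have : s = t := by
        have a1 : s < t + 1 := by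
          by_contra hc
          nlinarith
        have a2 : t < s + 1 := by
          by_contra hc
          nlinarith
        omega
      subst this
      exact ⟨s1, s2⟩
  obtain ⟨k1, k2⟩ := key N le_rfl
  push_cast at ht1
  linarith

theorem exists_near_residue {m c : ℤ} (hm : 0 < m) (hodd : m % 2 = 1) :
    ∃ y : ℤ, m ∣ c - y ∧ -m < 2 * y ∧ 2 * y < m := by
  have h0 := Int.emod_nonneg c hm.ne'
  have h1 := Int.emod_lt_of_pos c hm
  by_cases h : 2 * (c % m) < m
  · exact ⟨c % m, Int.dvd_self_sub_emod, by omega, h⟩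
  · refine ⟨c % m - m, ?_, by omega, by omega⟩
    have : c - (c % m - m) = (c - c % m) + m := by ring
    rw [this]
    exact dvd_add Int.dvd_self_sub_emod dvd_rfl

/-- A non-constant arithmetic progression modulo an odd number gets far from multiples. -/
theorem exists_far_of_not_dvd {n x y : ℤ} (hn : 0 < n) (hodd : n % 2 = 1) (hy : ¬ n ∣ y) :
    ∃ j : ℤ, FarFromMultiples n (x + j * y) := by
  by_contra! hc
  have hnear := fun j => nearMultiple_of_not_far hn hodd (hc j)
  obtain ⟨z, hz, z1, z2⟩ := exists_near_residue (c := y) hn hodd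
  have hz0 : z ≠ 0 := by
    rintro rfl
    exact hy (by simpa using hz)
  obtain ⟨N, hN⟩ : ∃ N : ℕ, (N : ℤ) = n := ⟨n.toNat, Int.toNat_of_nonneg hn.le⟩
  rcases lt_or_gt_of_ne hz0 with h | h
  · have := length_mul_step_lt (n := n) (x := x) (y := -z) (by omega) (by omega) N (fun j _ => by
      refine (hnear (-j)).of_dvd_sub ?_
      have : x + -(j : ℤ) * y - (x + j * -z) = -j * (y - z) := by ring
      rw [this]
      exact hz.mul_left _)
    nlinarith
  · have := length_mul_step_lt (n := n) (x := x) (y := z) (by omega) (by omega) N (fun j _ => by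
      refine (hnear j).of_dvd_sub ?_
      have : x + (j : ℤ) * y - (x + j * z) = j * (y - z) := by ring
      rw [this]
      exact hz.mul_left _)
    nlinarith

theorem exists_far_of_pos_residue {m c : ℤ} (hodd : m % 2 = 1) (hm3 : 3 ≤ m) (hm5 : m ≠ 5)
    (hc : 2 ≤ c) (hcm : 2 * c < m) :
    ∃ k : ℤ, FarFromMultiples m k ∧ FarFromMultiples m (k * c) := by
  by_contra! hno
  obtain ⟨N, hN⟩ : ∃ N : ℕ, (N : ℤ) = (3 * m - 1) / 4 - (m / 4 + 1) :=
    ⟨((3 * m - 1) / 4 - (m / 4 + 1)).toNat, Int.toNat_of_nonneg (by omega)⟩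
  have := length_mul_step_lt (n := m) (x := (m / 4 + 1) * c) (y := c) (by omega) hcm N
    (fun j hj => by
      have hk : FarFromMultiples m (m / 4 + 1 + j) := ⟨0, by omega, by omega⟩
      have := nearMultiple_of_not_far (by omega) hodd (hno _ hk)
      rwa [add_mul] at this)
  have : 2 * (N : ℤ) ≤ N * c := by nlinarith
  omega

theorem exists_far_multiplier {m c : ℤ} (hodd : m % 2 = 1) (hm3 : 3 ≤ m) (hm5 : m ≠ 5)
    (h0 : ¬ m ∣ c) (h1 : ¬ m ∣ c - 1) (h2 : ¬ m ∣ c + 1) :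
    ∃ k : ℤ, FarFromMultiples m k ∧ FarFromMultiples m (k * c) := by
  obtain ⟨y, hy, y1, y2⟩ := exists_near_residue (m := m) (c := c) (by omega) hodd
  have n0 : y ≠ 0 := by rintro rfl; exact h0 (by simpa using hy)
  have n1 : y ≠ 1 := by rintro rfl; exact h1 hy
  have n2 : y ≠ -1 := by rintro rfl; exact h2 (by simpa using hy)
  rcases lt_or_gt_of_ne n0 with h | h
  · obtain ⟨k, hk, hkc⟩ := exists_far_of_pos_residue hodd hm3 hm5 (c := -y) (by omega) (by omega)
    refine ⟨k, hk, ?_⟩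
    obtain ⟨t, t1, t2⟩ := hkc
    have hfar : FarFromMultiples m (k * y) := ⟨-t - 1, by linarith, by linarith⟩
    refine hfar.of_dvd_sub ?_
    rw [← mul_sub]
    exact ((dvd_sub_comm).mp hy).mul_left k
  · obtain ⟨k, hk, hkc⟩ := exists_far_of_pos_residue hodd hm3 hm5 (c := y) (by omega) (by omega)
    refine ⟨k, hk, hkc.of_dvd_sub ?_⟩
    rw [← mul_sub]
    exact ((dvd_sub_comm).mp hy).mul_left k

/-- Two residues modulo an odd `n`, not equal up to sign, have a common multiplier sending both far
from the multiples of `n`, unless up to sign they exhaust a subgroup of order five. -/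
theorem exists_common_far_multiplier {n a b : ℤ} (hn : 0 < n) (hodd : n % 2 = 1)
    (ha : ¬ n ∣ a) (hb : ¬ n ∣ b) (hsub : ¬ n ∣ a - b) (hadd : ¬ n ∣ a + b) :
    (∃ k : ℤ, FarFromMultiples n (k * a) ∧ FarFromMultiples n (k * b)) ∨
    (∃ d : ℤ, d ∣ n ∧ d ∣ a ∧ d ∣ b ∧
      ∀ z, d ∣ z → ¬ n ∣ z → n ∣ z - a ∨ n ∣ z + a ∨ n ∣ z - b ∨ n ∣ z + b) := by
  obtain ⟨d, hd, m, a₁, u, v, rfl, rfl, huv⟩ : ∃ d > 0, ∃ m a₁ u v : ℤ,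
      n = d * m ∧ a = d * a₁ ∧ u * a₁ + v * m = 1 := by
    have hg : 0 < (Int.gcd a n : ℤ) := by
      exact_mod_cast Int.gcd_pos_of_ne_zero_right a hn.ne'
    obtain ⟨a₁, ha₁⟩ := Int.gcd_dvd_left (a := a) (b := n)
    obtain ⟨m, hm⟩ := Int.gcd_dvd_right (a := a) (b := n)
    refine ⟨Int.gcd a n, hg, m, a₁, Int.gcdA a n, Int.gcdB a n, hm, ha₁, ?_⟩
    have hbez := Int.gcd_eq_gcd_ab a n
    apply mul_left_cancel₀ hg.ne'
    calc (Int.gcd a n : ℤ) * (Int.gcdA a n * a₁ + Int.gcdB a n * m)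
        = (Int.gcd a n * a₁) * Int.gcdA a n + (Int.gcd a n * m) * Int.gcdB a n := by ring
      _ = Int.gcd a n * 1 := by rw [← ha₁, ← hm, ← hbez, mul_one]
  have hm : 0 < m := pos_of_mul_pos_right hn hd.le
  have hmodd : m % 2 = 1 := by
    rcases Int.emod_two_eq_zero_or_one m with h | h
    · rw [Int.mul_emod, h] at hodd
      simp at hodd
    · exact h
  have hm3 : 3 ≤ m := by
    have : m ≠ 1 := by rintro rfl; exact ha (by simp)
    omega
  by_cases hdb : d ∣ b
  · obtain ⟨b₁, rfl⟩ := hdb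
    simp only [← mul_sub, ← mul_add, mul_dvd_mul_iff_left hd.ne'] at ha hb hsub hadd
    by_cases hm5 : m = 5
    · subst hm5
      refine .inr ⟨d, dvd_mul_right _ _, dvd_mul_right _ _, dvd_mul_right _ _, ?_⟩
      rintro _ ⟨z, rfl⟩ hz
      simp only [← mul_sub, ← mul_add, mul_dvd_mul_iff_left hd.ne'] at hz ⊢
      clear hn hodd huv
      have ha' : a₁ % 5 = 1 ∨ a₁ % 5 = 2 ∨ a₁ % 5 = 3 ∨ a₁ % 5 = 4 := by omega
      have hb' : b₁ % 5 = 1 ∨ b₁ % 5 = 2 ∨ b₁ % 5 = 3 ∨ b₁ % 5 = 4 := by omega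
      rcases ha' with h | h | h | h <;> rcases hb' with h' | h' | h' | h' <;> omega
    · left
      have cancel : ∀ e : ℤ, m ∣ u * b₁ - e → m ∣ b₁ - e * a₁ := by
        intro e he
        have : b₁ - e * a₁ = (u * b₁ - e) * a₁ + m * (v * b₁) := by
          linear_combination (-b₁) * huv
        rw [this]
        exact dvd_add (he.mul_right _) (dvd_mul_right _ _)
      obtain ⟨k, hk, hkc⟩ := exists_far_multiplier (c := u * b₁) hmodd hm3 hm5
        (fun h => hb (by simpa using cancel 0 (by simpa using h)))
        (fun h => hsub (by simpa using (dvd_sub_comm).mp (cancel 1 h)))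
        (fun h => hadd (by simpa [add_comm] using cancel (-1) (by simpa using h)))
      refine ⟨k * u, ?_, ?_⟩
      · have : k * u * (d * a₁) = d * (k * (u * a₁)) := by ring
        rw [this]
        refine (hk.of_dvd_sub ?_).mul_left hd
        exact ⟨k * v, by linear_combination (-k) * huv⟩
      · have : k * u * (d * b₁) = d * (k * (u * b₁)) := by ring
        rw [this]
        exact hkc.mul_left hd
  · left
    have hmb : ¬ d * m ∣ m * b := by
      rwa [mul_comm d m, mul_dvd_mul_iff_left hm.ne']
    obtain ⟨j, hj⟩ := exists_far_of_not_dvd (x := u * ((m + 1) / 2) * b) hn hodd hmb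
    refine ⟨u * ((m + 1) / 2) + j * m, ?_, ?_⟩
    · have hk : FarFromMultiples m ((m + 1) / 2) := ⟨0, by omega, by omega⟩
      refine (hk.mul_left hd).of_dvd_sub ⟨(m + 1) / 2 * v - j * a₁, ?_⟩
      linear_combination (-d * ((m + 1) / 2)) * huv
    · have : (u * ((m + 1) / 2) + j * m) * b = u * ((m + 1) / 2) * b + j * (m * b) := by ring
      rwa [this]

theorem circulantGraph_adj_iff_dvd {n a b : ℕ} (hn : 2 ≤ n) {x y : ZMod (2 * n)} :
    (SimpleGraph.circulantGraph {(a : ZMod (2 * n)), (b : ZMod (2 * n)), (n : ZMod (2 * n))}).Adj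
      x y ↔ x ≠ y ∧ ∃ s : ℤ, (s = a ∨ s = b ∨ s = n) ∧
        ((2 * n : ℤ) ∣ x.val - y.val - s ∨ (2 * n : ℤ) ∣ x.val - y.val + s) := by
  have : NeZero (2 * n) := ⟨by omega⟩
  have h1 : ∀ (x y : ZMod (2 * n)) (s : ℕ), x - y = s ↔ (2 * n : ℤ) ∣ x.val - y.val - s := by
    intro x y s
    have h := ZMod.intCast_zmod_eq_zero_iff_dvd ((x.val : ℤ) - y.val - s) (2 * n)
    push_cast [ZMod.natCast_zmod_val] at h
    rw [← h, sub_eq_zero]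
  have h2 : ∀ (x y : ZMod (2 * n)) (s : ℕ), y - x = s ↔ (2 * n : ℤ) ∣ x.val - y.val + s := by
    intro x y s
    rw [h1, ← dvd_neg]
    ring_nf
  simp only [SimpleGraph.circulantGraph, SimpleGraph.fromRel_adj, Set.mem_insert_iff,
    Set.mem_singleton_iff, h1]
  have h3 : ∀ s : ℕ, (2 * n : ℤ) ∣ y.val - x.val - s ↔ (2 * n : ℤ) ∣ x.val - y.val + s :=
    fun s => by rw [← h1, h2]
  simp only [h3]
  refine and_congr_right fun _ => ?_
  constructor
  · rintro ((h | h | h) | (h | h | h))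
    exacts [⟨a, by simp, .inl h⟩, ⟨b, by simp, .inl h⟩, ⟨n, by simp, .inl h⟩,
      ⟨a, by simp, .inr h⟩, ⟨b, by simp, .inr h⟩, ⟨n, by simp, .inr h⟩]
  · rintro ⟨s, (rfl | rfl | rfl), (h | h)⟩ <;> tauto

theorem circulantGraph_adj_iff_of_even {n a b : ℕ} (hn : 2 ≤ n) (hodd : n % 2 = 1)
    (ha : a % 2 = 0) (hb : b % 2 = 0) {x y : ZMod (2 * n)} :
    (SimpleGraph.circulantGraph {(a : ZMod (2 * n)), (b : ZMod (2 * n)), (n : ZMod (2 * n))}).Adj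
      x y ↔ x ≠ y ∧ ((x.val % 2 = y.val % 2 ∧ ∃ s : ℤ, (s = a ∨ s = b) ∧
        ((n : ℤ) ∣ x.val - y.val - s ∨ (n : ℤ) ∣ x.val - y.val + s)) ∨
        (x.val % 2 ≠ y.val % 2 ∧ (n : ℤ) ∣ x.val - y.val)) := by
  have h2n : ∀ z : ℤ, (2 * n : ℤ) ∣ z ↔ z % 2 = 0 ∧ (n : ℤ) ∣ z := by
    intro z
    rw [← Int.dvd_iff_emod_eq_zero]
    refine ⟨fun h => ⟨(dvd_mul_right _ _).trans h, (dvd_mul_left _ _).trans h⟩, fun h => ?_⟩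
    refine IsCoprime.mul_dvd ?_ h.1 h.2
    rw [Int.isCoprime_iff_gcd_eq_one]
    have : Nat.Coprime 2 n := (Nat.coprime_two_left).mpr (Nat.odd_iff.mpr hodd)
    exact_mod_cast this
  have hself : ∀ z : ℤ, ((n : ℤ) ∣ z - n ↔ (n : ℤ) ∣ z) ∧ ((n : ℤ) ∣ z + n ↔ (n : ℤ) ∣ z) :=
    fun z => ⟨dvd_sub_self_right, dvd_add_self_right⟩
  rw [circulantGraph_adj_iff_dvd hn]
  refine and_congr_right fun _ => ?_
  simp only [h2n]
  constructor
  · rintro ⟨s, hs | hs | rfl, h⟩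
    · exact .inl ⟨by omega, s, .inl hs, h.imp And.right And.right⟩
    · exact .inl ⟨by omega, s, .inr hs, h.imp And.right And.right⟩
    · rw [(hself _).1, (hself _).2] at h
      exact .inr ⟨by omega, h.elim And.right And.right⟩
  · rintro (⟨hp, s, hs, h⟩ | ⟨hp, h⟩)
    · refine ⟨s, hs.imp_right Or.inl, h.imp ?_ ?_⟩ <;> exact fun h => ⟨by omega, h⟩
    · exact ⟨n, by simp, .inl ⟨by omega, (hself _).1.mpr h⟩⟩

/-- A graph split into two layers by `p`, whose edges inside the layers change `r` and whose edges
between the layers preserve `r`, is word-representable as soon as directed paths inside a layer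
satisfy the semi-transitivity condition. -/
theorem wordRepresentable_of_layers {V : Type*} [DecidableEq V] [Fintype V] (G : SimpleGraph V)
    (p r : V → ℕ) (hp : ∀ x, p x ≤ 1)
    (hadj : ∀ x y, G.Adj x y → (p x = p y ∧ r x ≠ r y) ∨ (p x ≠ p y ∧ r x = r y))
    (hst : ∀ u v w,
      Relation.TransGen (orientedEdge G fun x => r x + p x) u v →
      Relation.TransGen (orientedEdge G fun x => r x + p x) v w →
      p u = p v → p v = p w → r u < r v → r v < r w → G.Adj u w → G.Adj u v ∧ G.Adj v w) :
    WordRepresentable G := by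
  have mono : ∀ {u v}, Relation.TransGen (orientedEdge G fun x => r x + p x) u v →
      p u ≤ p v ∧ r u ≤ r v ∧ r u + p u < r v + p v := by
    have step : ∀ {u v}, orientedEdge G (fun x => r x + p x) u v →
        p u ≤ p v ∧ r u ≤ r v ∧ r u + p u < r v + p v := by
      rintro u v ⟨h1, h2⟩
      dsimp only at h2
      have := hadj u v h1
      have := hp u
      have := hp v
      omega
    intro u v h
    induction h with
    | single e => exact step e
    | tail _ e ih =>
      have := step e
      omega
  refine wordRepresentable_of_semiTransitive G (fun x => r x + p x) ?_ ?_
  · intro x y h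
    have := hadj x y h
    have := hp x
    have := hp y
    omega
  · intro u v w huv hvw huw
    have h1 := mono huv
    have h2 := mono hvw
    have h3 := hadj u w huw
    have := hp u
    have := hp w
    exact hst u v w huv hvw (by omega) (by omega) (by omega) (by omega) huw

/-- Residues whose difference is far from the multiples of `n` differ by between one and three
quarters of `n`. -/
theorem residue_gap {n x y g : ℤ} (hx0 : 0 ≤ x) (hxn : x < n) (hy0 : 0 ≤ y) (hyn : y < n)
    (hg : FarFromMultiples n g) (h : n ∣ x - y - g ∨ n ∣ x - y + g) :
    n < 4 * |x - y| ∧ 4 * |x - y| < 3 * n := by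
  obtain ⟨t, t1, t2⟩ := hg
  have hn : 0 < n := by omega
  obtain ⟨e, f, hf, e1, e2⟩ : ∃ e f : ℤ, x - y = e + f * n ∧ n < 4 * e ∧ 4 * e < 3 * n := by
    rcases h with ⟨s, hs⟩ | ⟨s, hs⟩
    · exact ⟨g - t * n, s + t, by linarith, t1, t2⟩
    · exact ⟨n - (g - t * n), s - t - 1, by linarith, by linarith, by linarith⟩
  have f1 : f < 1 := by by_contra hc; nlinarith
  have f2 : -2 < f := by by_contra hc; nlinarith
  have f3 : f = 0 ∨ f = -1 := by omega
  rcases f3 with rfl | rfl <;> rcases abs_cases (x - y) with h | h <;> constructor <;> linarith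

theorem wordRepresentable_of_odd {n a b : ℕ} (hn : 2 ≤ n) (hodd : n % 2 = 1)
    (ha : a % 2 = 1) (hb : b % 2 = 1) :
    WordRepresentable (SimpleGraph.circulantGraph
      {(a : ZMod (2 * n)), (b : ZMod (2 * n)), (n : ZMod (2 * n))}) := by
  have : NeZero (2 * n) := ⟨by omega⟩
  have hlt : ∀ {G : SimpleGraph (ZMod (2 * n))} {u v}, Relation.TransGen
      (orientedEdge G fun x => x.val % 2) u v → u.val % 2 < v.val % 2 := by
    intro G u v h
    induction h with
    | single e => exact e.2
    | tail _ e ih => exact ih.trans e.2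
  refine wordRepresentable_of_semiTransitive _ (fun x => x.val % 2) ?_ ?_
  · intro x y h
    rw [circulantGraph_adj_iff_dvd hn] at h
    obtain ⟨-, s, hs, h⟩ := h
    have h' : (2 : ℤ) ∣ x.val - y.val - s ∨ (2 : ℤ) ∣ x.val - y.val + s :=
      h.imp (dvd_mul_right _ _).trans (dvd_mul_right _ _).trans
    omega
  · intro u v w huv hvw
    have := hlt huv
    have := hlt hvw
    omega

theorem wordRepresentable_of_even {n a b : ℕ} (hn : 2 ≤ n) (hodd : n % 2 = 1)
    (ha : 0 < a) (hab : a < b) (hbn : b < n) (ha2 : a % 2 = 0) (hb2 : b % 2 = 0) :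
    WordRepresentable (SimpleGraph.circulantGraph
      {(a : ZMod (2 * n)), (b : ZMod (2 * n)), (n : ZMod (2 * n))}) := by
  have hiff := @circulantGraph_adj_iff_of_even n a b hn hodd ha2 hb2
  generalize SimpleGraph.circulantGraph
    {(a : ZMod (2 * n)), (b : ZMod (2 * n)), (n : ZMod (2 * n))} = G at hiff ⊢
  have : NeZero (2 * n) := ⟨by omega⟩
  have hn0 : (0 : ℤ) < n := by omega
  have hna : ¬ (n : ℤ) ∣ a := fun h => by have := Int.le_of_dvd (by omega) h; omega
  have hnb : ¬ (n : ℤ) ∣ b := fun h => by have := Int.le_of_dvd (by omega) h; omega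
  have hsub : ¬ (n : ℤ) ∣ a - b := fun h => by
    have := Int.le_of_dvd (by omega) (dvd_sub_comm.mp h)
    omega
  have hadd : ¬ (n : ℤ) ∣ a + b := by
    rintro ⟨c, hc⟩
    have c1 : 0 < c := by by_contra hc'; nlinarith
    have c2 : c < 2 := by by_contra hc'; nlinarith
    obtain rfl : c = 1 := by omega
    omega
  rcases exists_common_far_multiplier hn0 (by omega) hna hnb hsub hadd with
    ⟨k, hka, hkb⟩ | ⟨d, hdn, hda, hdb, hd⟩
  · let r : ZMod (2 * n) → ℕ := fun x => ((k * x.val) % n).toNat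
    have hr : ∀ x, (r x : ℤ) = (k * x.val) % n :=
      fun x => Int.toNat_of_nonneg (Int.emod_nonneg _ hn0.ne')
    have hrn : ∀ x, (r x : ℤ) < n := fun x => by rw [hr]; exact Int.emod_lt_of_pos _ hn0
    have hrd : ∀ x y (s : ℤ), (n : ℤ) ∣ x.val - y.val - s → (n : ℤ) ∣ r x - r y - k * s := by
      intro x y s h
      rw [hr, hr]
      have e : (k * x.val % n - k * y.val % n - k * s : ℤ) =
          k * (x.val - y.val - s) - (k * x.val - k * x.val % n) +
            (k * y.val - k * y.val % n) := by ring
      rw [e]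
      exact dvd_add (dvd_sub (h.mul_left _) Int.dvd_self_sub_emod) Int.dvd_self_sub_emod
    have hgap : ∀ x y, G.Adj x y → x.val % 2 = y.val % 2 →
        (n : ℤ) < 4 * |(r x : ℤ) - r y| ∧ 4 * |(r x : ℤ) - r y| < 3 * n := by
      intro x y h hxy
      rw [hiff] at h
      obtain ⟨-, ⟨-, s, hs, h⟩ | ⟨h, -⟩⟩ := h
      · refine residue_gap (by omega) (hrn x) (by omega) (hrn y) (g := k * s) ?_ ?_
        · rcases hs with rfl | rfl
          exacts [hka, hkb]
        · refine h.imp (hrd x y s) fun h => ?_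
          have := hrd x y (-s) (by rwa [sub_neg_eq_add])
          rwa [mul_neg, sub_neg_eq_add] at this
      · exact absurd hxy h
    have hadj : ∀ x y, G.Adj x y →
        (x.val % 2 = y.val % 2 ∧ r x ≠ r y) ∨ (x.val % 2 ≠ y.val % 2 ∧ r x = r y) := by
      intro x y h
      by_cases hxy : x.val % 2 = y.val % 2
      · have := hgap x y h hxy
        refine .inl ⟨hxy, fun he => ?_⟩
        rw [he, sub_self, abs_zero] at this
        omega
      · refine .inr ⟨hxy, ?_⟩
        rw [hiff] at h
        obtain ⟨-, ⟨h, -⟩ | ⟨-, h⟩⟩ := h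
        · exact absurd h hxy
        · have h' := hrd x y 0 (by simpa using h)
          rw [mul_zero, sub_zero] at h'
          have hx := hrn x
          have hy := hrn y
          have := Int.eq_zero_of_abs_lt_dvd h' (by rw [abs_lt]; omega)
          omega
    have hstep : ∀ {u v}, orientedEdge G (fun x => r x + x.val % 2) u v → u.val % 2 ≤ v.val % 2 ∧
        (u.val % 2 = v.val % 2 → (n : ℤ) < 4 * ((r v : ℤ) - r u)) := by
      rintro u v ⟨h1, h2⟩
      dsimp only at h2
      have h3 := hadj u v h1
      refine ⟨by omega, fun h4 => ?_⟩
      have := (hgap u v h1 h4).1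
      rwa [abs_sub_comm, abs_of_nonneg (by omega)] at this
    have hpath : ∀ {u v}, Relation.TransGen (orientedEdge G (fun x => r x + x.val % 2)) u v →
        u.val % 2 ≤ v.val % 2 ∧
        (u.val % 2 = v.val % 2 → (n : ℤ) < 4 * ((r v : ℤ) - r u) ∧
          (G.Adj u v ∨ (n : ℤ) < 2 * ((r v : ℤ) - r u))) := by
      intro u v h
      induction h with
      | single e => exact ⟨(hstep e).1, fun h => ⟨(hstep e).2 h, .inl e.1⟩⟩
      | tail _ e ih =>
        obtain ⟨e1, e2⟩ := hstep e
        obtain ⟨i1, i2⟩ := ih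
        refine ⟨i1.trans e1, fun h => ?_⟩
        have := e2 (by omega)
        have := (i2 (by omega)).1
        exact ⟨by omega, .inr (by omega)⟩
    refine wordRepresentable_of_layers _ (fun x => x.val % 2) r (fun x => by omega) hadj ?_
    intro u v w huv hvw puv pvw _ _ huw
    obtain ⟨g1, g2⟩ := (hpath huv).2 puv
    obtain ⟨g3, g4⟩ := (hpath hvw).2 pvw
    have g5 := (hgap u w huw (puv.trans pvw)).2
    have g6 := neg_abs_le ((r u : ℤ) - r w)
    exact ⟨g2.resolve_right (by omega), g4.resolve_right (by omega)⟩
  · have hmod : ∀ x y : ZMod (2 * n), x.val % n = y.val % n ↔ (n : ℤ) ∣ x.val - y.val := by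
      intro x y
      rw [dvd_sub_comm]
      exact Nat.modEq_iff_dvd
    have hpath : ∀ {u v}, Relation.TransGen (orientedEdge G (fun x => x.val % n + x.val % 2)) u v →
        d ∣ (u.val : ℤ) - v.val := by
      have hstep : ∀ {u v}, G.Adj u v → d ∣ (u.val : ℤ) - v.val := by
        intro u v h
        rw [hiff] at h
        obtain ⟨-, ⟨-, s, hs, h⟩ | ⟨-, h⟩⟩ := h
        · have hds : d ∣ s := by rcases hs with rfl | rfl <;> assumption
          rcases h with h | h
          · exact (dvd_sub_left hds).mp (hdn.trans h)
          · exact (dvd_add_left hds).mp (hdn.trans h)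
        · exact hdn.trans h
      intro u v h
      induction h with
      | single e => exact hstep e.1
      | tail _ e ih => simpa using dvd_add ih (hstep e.1)
    have hclique : ∀ {u v : ZMod (2 * n)}, d ∣ (u.val : ℤ) - v.val → u.val % 2 = v.val % 2 →
        u.val % n < v.val % n → G.Adj u v := by
      intro u v huv hp hr
      rw [hiff]
      refine ⟨by rintro rfl; omega, .inl ⟨hp, ?_⟩⟩
      rcases hd _ huv (fun h => hr.ne ((hmod u v).mpr h)) with h | h | h | h
      exacts [⟨a, .inl rfl, .inl h⟩, ⟨a, .inl rfl, .inr h⟩, ⟨b, .inr rfl, .inl h⟩,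
        ⟨b, .inr rfl, .inr h⟩]
    refine wordRepresentable_of_layers _ (fun x => x.val % 2) (fun x => x.val % n)
      (fun x => by omega) ?_ ?_
    · intro x y h
      rw [hiff] at h
      obtain ⟨-, ⟨hp, s, hs, h⟩ | ⟨hp, h⟩⟩ := h
      · refine .inl ⟨hp, fun he => ?_⟩
        have hns : ¬ (n : ℤ) ∣ s := by rcases hs with rfl | rfl <;> assumption
        have he' := (hmod x y).mp he
        exact hns (h.elim (dvd_sub_right he').mp (dvd_add_right he').mp)
      · exact .inr ⟨hp, (hmod x y).mpr h⟩
    · intro u v w huv hvw puv pvw ruv rvw _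
      exact ⟨hclique (hpath huv) puv ruv, hclique (hpath hvw) pvw rvw⟩

theorem stmt0 (n a b : ℕ) (hn : 2 ≤ n) (hodd : Odd n)
    (ha : 0 < a) (hab : a < b) (hbn : b < n) (hpar : a % 2 = b % 2) :
    WordRepresentable (SimpleGraph.circulantGraph {((a : ℕ) : ZMod (2*n)), ((b : ℕ) : ZMod (2*n)), ((n : ℕ) : ZMod (2*n))}) := by
  have hodd' := Nat.odd_iff.mp hodd
  rcases Nat.mod_two_eq_zero_or_one a with h | h
  · exact wordRepresentable_of_even hn hodd' ha hab hbn h (by omega)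
  · exact wordRepresentable_of_odd hn hodd' h (by omega)
end

section
/- Let n ≥ 2 and let a, b be integers with 0 < a < b < n, and let G = C_{2n}(a,b,n). Suppose there exist a generator g of the additive cyclic group Z_{2n} and integers p, q with 1 ≤ p, q ≤ 2n − 1 such that a ≡ p·g (mod 2n), b ≡ q·g (mod 2n), and min{p, q, 2n − p, 2n − q} ≥ ⌈2n/3⌉. Then G is word-representable. -/
/-- A word over `{x, y}` obtained by repeating `xyxy` has no two equal consecutive letters. -/
lemma isChain_flatMap_alternating {ι V : Type*} {x y : V} (hxy : x ≠ y) (l : List ι) :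
    (l.flatMap fun _ => [x, y, x, y]).IsChain (· ≠ ·) := by
  induction l with
  | nil => simp
  | cons i l ih =>
    cases l with
    | nil => simp [hxy, hxy.symm]
    | cons j l => simpa [hxy, hxy.symm] using ih

lemma alternate_iff_isChain {V : Type*} [DecidableEq V] {w : List V} {x y : V} :
    Alternate w x y ↔ (w.filter (fun z => decide (z = x ∨ z = y))).IsChain (· ≠ ·) :=
  Iff.rfl

lemma Alternate.symm {V : Type*} [DecidableEq V] {w : List V} {x y : V}
    (h : Alternate w x y) : Alternate w y x := by
  unfold Alternate at h ⊢
  simpa only [or_comm] using h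

/-- Letters alternating in a word alternate in each of its factors. -/
lemma Alternate.of_isInfix {V : Type*} [DecidableEq V] {v w : List V} {x y : V}
    (h : Alternate w x y) (hv : v <:+: w) : Alternate v x y :=
  List.IsChain.infix h (hv.filter _)

/-- A list of all vertices in order of increasing colour. -/
lemma exists_list_filter_eq_pair {V : Type*} [Fintype V] [DecidableEq V] (c : V → ℕ) :
    ∃ L : List V, (∀ v, v ∈ L) ∧
      ∀ x y, c x < c y → L.filter (fun z => decide (z = x ∨ z = y)) = [x, y] := by
  let r : V → V → Prop := fun x y => c x ≤ c y
  have : Std.Total r := ⟨fun x y => le_total (c x) (c y)⟩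
  have : IsTrans V r := ⟨fun _ _ _ => le_trans⟩
  have hperm := List.perm_insertionSort r (Finset.univ : Finset V).toList
  have hsort := List.pairwise_insertionSort r (Finset.univ : Finset V).toList
  set L := List.insertionSort r (Finset.univ : Finset V).toList
  have hmem : ∀ v, v ∈ L := fun v => hperm.mem_iff.2 (by simp)
  have hnodup : L.Nodup := hperm.nodup_iff.2 (Finset.nodup_toList _)
  refine ⟨L, hmem, fun x y hxy => ?_⟩
  have hne : x ≠ y := fun h => by simp [h] at hxy
  have hp : (L.filter (fun z => decide (z = x ∨ z = y))).Perm [x, y] := by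
    rw [List.perm_ext_iff_of_nodup (hnodup.filter _) (by simp [hne])]
    simp [hmem]
  refine hp.eq_of_pairwise ?_ (hsort.filter _) (by simpa [r] using hxy.le)
  intro a b ha hb hab hba
  have ha' := hp.mem_iff.1 ha
  simp only [List.mem_cons, List.not_mem_nil, or_false] at ha' hb
  simp only [r] at hab hba
  rcases ha' with rfl | rfl <;> rcases hb with rfl | rfl <;> first | rfl | omega

/-- A nonadjacent pair can be separated by a factor in which every properly ordered edge `xy`
reads `xyxy`. -/
lemma exists_separating_block {V : Type*} [DecidableEq V] (c : V → ℕ)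
    (hc : ∀ v, c v ≤ 2) {L : List V}
    (hL : ∀ x y, c x < c y → L.filter (fun z => decide (z = x ∨ z = y)) = [x, y])
    {u w : V} (huw : u ≠ w) (hcuw : c u ≤ c w) :
    ∃ v : List V, ¬ Alternate v u w ∧
      ∀ x y, c x < c y → ¬ (x = u ∧ y = w) →
        v.filter (fun z => decide (z = x ∨ z = y)) = [x, y, x, y] := by
  have hfilter : ∀ (P : V → Bool) (x y : V), c x < c y →
      (L.filter P).filter (fun z => decide (z = x ∨ z = y)) = [x, y].filter P := by
    intro P x y h
    rw [List.filter_comm, hL x y h]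
  by_cases hlast : c w ≤ c u + 1
  · let P : V → Bool := fun z => decide (c z ≤ c u ∧ z ≠ u ∧ z ≠ w)
    let Q : V → Bool := fun z => decide (c u < c z ∧ z ≠ w)
    refine ⟨L.filter P ++ [u, w] ++ L.filter Q ++ (L.filter P ++ [w, u] ++ L.filter Q), ?_, ?_⟩
    · have hP : (L.filter P).filter (fun z => decide (z = u ∨ z = w)) = [] := by
        simp only [List.filter_filter, List.filter_eq_nil_iff]
        intro z _
        simp only [P, Bool.and_eq_true, decide_eq_true_eq]
        tauto
      have hQ : (L.filter Q).filter (fun z => decide (z = u ∨ z = w)) = [] := by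
        simp only [List.filter_filter, List.filter_eq_nil_iff]
        intro z _
        simp only [Q, Bool.and_eq_true, decide_eq_true_eq]
        rintro ⟨rfl | rfl, h, h'⟩
        · exact lt_irrefl _ h
        · exact h' rfl
      rw [alternate_iff_isChain]
      simp only [List.filter_append, hP, hQ]
      simp
    · intro x y hxy hne
      simp only [List.filter_append, hfilter _ x y hxy]
      have hx : x ≠ y := fun h => by simp [h] at hxy
      simp only [P, Q, List.filter_cons, List.filter_nil]
      grind
  · have hu : c u = 0 := by have := hc w; omega
    have hw : c w = 2 := by have := hc w; omega
    refine ⟨L.filter (fun z => decide (z ≠ w)) ++ [u, w] ++ L.filter (fun z => decide (z ≠ u)),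
      ?_, ?_⟩
    · rw [alternate_iff_isChain]
      simp only [List.filter_append, hfilter _ u w (by omega)]
      simp [huw, huw.symm]
    · intro x y hxy hne
      simp only [List.filter_append, hfilter _ x y hxy]
      have hx : x ≠ y := fun h => by simp [h] at hxy
      have hyu : y ≠ u := fun h => by subst h; omega
      have hxw : x ≠ w := fun h => by have := hc y; subst h; omega
      simp only [List.filter_cons, List.filter_nil]
      grind

/-- Every finite 3-colourable graph is word-representable. -/
theorem WordRepresentable.of_three_coloring {V : Type*} [Fintype V] [DecidableEq V]
    (G : SimpleGraph V) (c : V → ℕ) (hc : ∀ v, c v ≤ 2)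
    (hG : ∀ x y, G.Adj x y → c x ≠ c y) : WordRepresentable G := by
  classical
  obtain ⟨L, hmem, hL⟩ := exists_list_filter_eq_pair c
  have hblock : ∀ e : V × V, ∃ v : List V,
      (e.1 ≠ e.2 → c e.1 ≤ c e.2 → ¬ G.Adj e.1 e.2 → ¬ Alternate v e.1 e.2) ∧
      ∀ x y, c x < c y → G.Adj x y →
        v.filter (fun z => decide (z = x ∨ z = y)) = [x, y, x, y] := by
    rintro ⟨u, w⟩
    by_cases h : u ≠ w ∧ c u ≤ c w ∧ ¬ G.Adj u w
    · obtain ⟨v, hv, hv'⟩ := exists_separating_block c hc hL h.1 h.2.1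
      exact ⟨v, fun _ _ _ => hv, fun x y hxy hadj => hv' x y hxy
        (by rintro ⟨rfl, rfl⟩; exact h.2.2 hadj)⟩
    · refine ⟨L ++ L, fun h1 h2 h3 => absurd ⟨h1, h2, h3⟩ h, fun x y hxy _ => ?_⟩
      rw [List.filter_append, hL x y hxy]
      rfl
  choose B hB hB' using hblock
  let E : List (V × V) := Finset.univ.toList
  let W : List V := E.flatMap B
  have hedge : ∀ x y, c x < c y → G.Adj x y → Alternate (L ++ L ++ W) x y := by
    intro x y hxy hadj
    have hne : x ≠ y := hadj.ne
    have key : (L ++ L ++ W).filter (fun z => decide (z = x ∨ z = y)) =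
        (none :: E.map some).flatMap fun _ => [x, y, x, y] := by
      simp only [W, List.filter_append, hL x y hxy, List.filter_flatMap, List.flatMap_cons,
        List.flatMap_map, hB' _ x y hxy hadj]
      rfl
    rw [alternate_iff_isChain, key]
    exact isChain_flatMap_alternating hne _
  have hnonedge : ∀ x y, x ≠ y → c x ≤ c y → ¬ G.Adj x y → ¬ Alternate (L ++ L ++ W) x y := by
    intro x y hne hxy hadj halt
    have hfactor : B (x, y) <:+: W := by
      obtain ⟨s, t, hst⟩ := List.append_of_mem (show (x, y) ∈ E by simp [E])
      exact ⟨s.flatMap B, t.flatMap B, by simp [W, hst]⟩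
    exact hB (x, y) hne hxy hadj
      (halt.of_isInfix (hfactor.trans (List.suffix_append (L ++ L) W).isInfix))
  refine ⟨L ++ L ++ W, fun v => by simp [hmem], fun x y hne => ?_⟩
  rcases le_total (c x) (c y) with h | h
  · exact ⟨fun hadj => hedge x y (lt_of_le_of_ne h (hG x y hadj)) hadj,
      fun halt => by_contra fun hadj => hnonedge x y hne h hadj halt⟩
  · exact ⟨fun hadj => (hedge y x (lt_of_le_of_ne h (hG x y hadj).symm) hadj.symm).symm,
      fun halt => by_contra fun hadj =>
        hnonedge y x hne.symm h (fun h' => hadj h'.symm) halt.symm⟩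

/-- Residues at circular distance at least `m` lie in different intervals of length `m`. -/
lemma ZMod.val_div_ne_of_le_val_sub {N m : ℕ} [NeZero N] {x y : ZMod N} (hm : 0 < m)
    (h₁ : m ≤ (x - y).val) (h₂ : (x - y).val + m ≤ N) : x.val / m ≠ y.val / m := by
  intro h
  have hval : x.val = ((x - y).val + y.val) % N := by
    rw [← ZMod.val_add, sub_add_cancel]
  have hx := Nat.div_add_mod x.val m
  have hy := Nat.div_add_mod y.val m
  have hx' := Nat.mod_lt x.val hm
  have hy' := Nat.mod_lt y.val hm
  rw [h] at hx
  have hyN := ZMod.val_lt y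
  rcases lt_or_ge ((x - y).val + y.val) N with hlt | hge
  · rw [Nat.mod_eq_of_lt hlt] at hval
    omega
  · rw [Nat.mod_eq_sub_mod hge, Nat.mod_eq_of_lt (by omega)] at hval
    omega

/-- Multiplication by a unit fixes the element of order two of `ZMod (2 * n)`. -/
lemma ZMod.natCast_half_mul_eq {n : ℕ} (hn : 0 < n) {g h : ZMod (2 * n)} (hgh : g * h = 1) :
    (n : ZMod (2 * n)) * h = n := by
  have : NeZero (2 * n) := ⟨by omega⟩
  have hodd : Odd h.val := by
    by_contra hcon
    obtain ⟨k, hk⟩ := Nat.not_odd_iff_even.1 hcon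
    have hzero : (n : ZMod (2 * n)) * h = 0 := by
      rw [← ZMod.natCast_zmod_val h, ← Nat.cast_mul, ZMod.natCast_eq_zero_iff]
      exact ⟨k, by rw [hk]; ring⟩
    have hn0 : (n : ZMod (2 * n)) = 0 := by
      calc (n : ZMod (2 * n)) = n * (g * h) := by rw [hgh, mul_one]
        _ = n * h * g := by ring
        _ = 0 := by rw [hzero, zero_mul]
    have := Nat.le_of_dvd hn ((ZMod.natCast_eq_zero_iff _ _).1 hn0)
    omega
  obtain ⟨k, hk⟩ := hodd
  have h2n : (2 : ZMod (2 * n)) * n = 0 := by exact_mod_cast ZMod.natCast_self (2 * n)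
  rw [← ZMod.natCast_zmod_val h, hk]
  push_cast
  linear_combination (k : ZMod (2 * n)) * h2n

theorem stmt2 (n a b : ℕ) (hn : 2 ≤ n)
    (ha : 0 < a) (hab : a < b) (hbn : b < n)
    (g : ZMod (2*n)) (hg : addOrderOf g = 2*n)
    (p q : ℕ) (hp1 : 1 ≤ p) (hp2 : p ≤ 2*n - 1) (hq1 : 1 ≤ q) (hq2 : q ≤ 2*n - 1)
    (hag : ((a : ℕ) : ZMod (2*n)) = p • g)
    (hbg : ((b : ℕ) : ZMod (2*n)) = q • g)
    (hmin : (2*n + 2) / 3 ≤ min (min p q) (min (2*n - p) (2*n - q))) :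
    WordRepresentable (SimpleGraph.circulantGraph {((a : ℕ) : ZMod (2*n)), ((b : ℕ) : ZMod (2*n)), ((n : ℕ) : ZMod (2*n))}) := by
  have : NeZero (2 * n) := ⟨by omega⟩
  obtain ⟨h, hgh⟩ : ∃ h : ZMod (2 * n), g * h = 1 := by
    have htop : AddSubgroup.zmultiples g = ⊤ := by
      apply AddSubgroup.eq_top_of_card_eq
      rw [Nat.card_zmultiples, hg, Nat.card_zmod]
    obtain ⟨k, hk⟩ := AddSubgroup.mem_zmultiples_iff.1
      (htop ▸ AddSubgroup.mem_top (1 : ZMod (2 * n)))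
    exact ⟨k, by rwa [zsmul_eq_mul, mul_comm (k : ZMod (2 * n))] at hk⟩
  simp only [le_min_iff] at hmin
  obtain ⟨⟨hp, hq⟩, hp', hq'⟩ := hmin
  set m := (2 * n + 2) / 3 with hm
  have hjump : ∀ s ∈ ({((a : ℕ) : ZMod (2*n)), ((b : ℕ) : ZMod (2*n)), ((n : ℕ) : ZMod (2*n))} :
      Set (ZMod (2 * n))), m ≤ (s * h).val ∧ (s * h).val + m ≤ 2 * n := by
    rintro s (rfl | rfl | rfl)
    · rw [hag, nsmul_eq_mul, mul_assoc, hgh, mul_one, ZMod.val_natCast_of_lt (by omega)]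
      omega
    · rw [hbg, nsmul_eq_mul, mul_assoc, hgh, mul_one, ZMod.val_natCast_of_lt (by omega)]
      omega
    · rw [ZMod.natCast_half_mul_eq (by omega) hgh, ZMod.val_natCast_of_lt (by omega)]
      omega
  have hne : ∀ x y : ZMod (2 * n),
      x - y ∈ ({((a : ℕ) : ZMod (2*n)), ((b : ℕ) : ZMod (2*n)), ((n : ℕ) : ZMod (2*n))} :
        Set (ZMod (2 * n))) → (x * h).val / m ≠ (y * h).val / m := by
    intro x y hxy
    obtain ⟨h₁, h₂⟩ := hjump _ hxy
    rw [sub_mul] at h₁ h₂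
    exact ZMod.val_div_ne_of_le_val_sub (by omega) h₁ h₂
  refine WordRepresentable.of_three_coloring _ (fun x => (x * h).val / m) (fun x => ?_) ?_
  · have hlt := ZMod.val_lt (x * h)
    exact Nat.le_of_lt_succ ((Nat.div_lt_iff_lt_mul (by omega)).2 (by omega))
  · intro x y hadj
    rw [SimpleGraph.circulantGraph_adj] at hadj
    rcases hadj with ⟨_, hxy | hxy⟩
    · exact hne x y hxy
    · exact (hne y x hxy).symm
end

section
/- Let n ≥ 3 and let x be an integer with 1 < x < n. If n ≡ 0 (mod 3), x ≡ 1 (mod 3), and 2x < n, then the 5-regular circulant graph C_{2n}(x,1,n) is word-representable. -/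
lemma alternate_comm {V : Type*} [DecidableEq V] (w : List V) (x y : V) :
    Alternate w x y ↔ Alternate w y x := by
  simp only [Alternate, or_comm]

lemma flatMap_range_eq {V : Type*} (h : ℕ → List V) (l : List ℕ) (N : ℕ)
    (hl : l.Pairwise (· < ·)) (hN : ∀ i ∈ l, i < N) (hh : ∀ i, i ∉ l → h i = []) :
    (List.range N).flatMap h = l.flatMap h := by
  have hf : (List.range N).filter (fun i => decide (i ∈ l)) = l := by
    apply List.Perm.eq_of_pairwise (le := (· < ·))
    · intro a b _ _ hab hba
      exact absurd hab (lt_asymm hba)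
    · exact List.pairwise_lt_range.filter _
    · exact hl
    · rw [List.perm_ext_iff_of_nodup (List.nodup_range.filter _) (hl.imp ne_of_lt)]
      intro a
      simpa using hN a
  conv_rhs => rw [← hf]
  generalize List.range N = r
  induction r with
  | nil => rfl
  | cons a r ih => by_cases ha : a ∈ l <;> simp [ha, ih, hh]

/-- The word in which the letter `v` occurs at the two times `p v` and `q v`. -/
noncomputable def twoTimeWord {V : Type*} [Fintype V] (p q : V → ℕ) (N : ℕ) : List V :=
  (List.range N).flatMap fun i => Finset.univ.toList.filter fun v => decide (p v = i ∨ q v = i)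

lemma filter_twoTimeWord {V : Type*} [Fintype V] [DecidableEq V] (p q : V → ℕ) (N : ℕ)
    (s t : V) (l : List ℕ) (hl : l.Pairwise (· < ·)) (hN : ∀ i ∈ l, i < N)
    (hmem : ∀ i, i ∈ l ↔ i = p s ∨ i = q s ∨ i = p t ∨ i = q t)
    (hpp : p s ≠ p t) (hpq : p s ≠ q t) (hqp : q s ≠ p t) (hqq : q s ≠ q t) :
    (twoTimeWord p q N).filter (fun z => decide (z = s ∨ z = t)) =
      l.map fun i => if p s = i ∨ q s = i then s else t := by
  have hst : s ≠ t := fun h => hpp (h ▸ rfl)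
  have key : ∀ i, (Finset.univ.toList.filter fun v => decide (p v = i ∨ q v = i)).filter
      (fun z => decide (z = s ∨ z = t)) =
      if p s = i ∨ q s = i then [s] else if p t = i ∨ q t = i then [t] else [] := by
    intro i
    have hone : ∀ a : V, (Finset.univ.toList : List V).filter (fun z => decide (z = a)) = [a] := by
      intro a
      rw [← List.perm_singleton,
        List.perm_ext_iff_of_nodup ((Finset.nodup_toList _).filter _) (List.nodup_singleton a)]
      simp
    rw [List.filter_filter]
    split_ifs with h₁ h₂
    · rw [← hone s]
      refine List.filter_congr fun z _ => ?_
      by_cases hzs : z = s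
      · subst hzs; simp [h₁]
      · by_cases hzt : z = t
        · subst hzt; simp [hzs]; omega
        · simp [hzs, hzt]
    · rw [← hone t]
      refine List.filter_congr fun z _ => ?_
      by_cases hzt : z = t
      · subst hzt; simp [h₂]
      · by_cases hzs : z = s
        · subst hzs; simp [hzt]; omega
        · simp [hzs, hzt]
    · rw [List.filter_eq_nil_iff]
      intro z _
      simp only [Bool.and_eq_true, decide_eq_true_eq, not_and]
      rintro (rfl | rfl) <;> assumption
  rw [twoTimeWord, List.filter_flatMap]
  simp only [key]
  rw [flatMap_range_eq _ l N hl hN]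
  · rw [List.map_eq_flatMap]
    refine List.flatMap_congr fun i hi => ?_
    rw [hmem] at hi
    split_ifs
    · rfl
    · rfl
    · omega
  · intro i hi
    rw [hmem] at hi
    rw [if_neg (by omega), if_neg (by omega)]

lemma filter_twoTimeWord_alternating {V : Type*} [Fintype V] [DecidableEq V] {p q : V → ℕ} {N : ℕ}
    {s t : V} (h₁ : p s < p t) (h₂ : p t < q s) (h₃ : q s < q t) (h₄ : q t < N) :
    (twoTimeWord p q N).filter (fun z => decide (z = s ∨ z = t)) = [s, t, s, t] := by
  rw [filter_twoTimeWord p q N s t [p s, p t, q s, q t]]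
  · simp; omega
  all_goals simp
  all_goals omega

lemma not_alternate_twoTimeWord_nested {V : Type*} [Fintype V] [DecidableEq V] {p q : V → ℕ} {N : ℕ}
    {s t : V} (h₁ : p s < p t) (h₂ : p t < q t) (h₃ : q t < q s) (h₄ : q s < N) :
    ¬ Alternate (twoTimeWord p q N) s t := by
  have : (twoTimeWord p q N).filter (fun z => decide (z = s ∨ z = t)) = [s, t, t, s] := by
    rw [filter_twoTimeWord p q N s t [p s, p t, q t, q s]]
    · simp; omega
    all_goals simp
    all_goals omega
  rw [Alternate, this]
  change ¬ List.IsChain _ _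
  simp

lemma not_alternate_twoTimeWord_disjoint {V : Type*} [Fintype V] [DecidableEq V] {p q : V → ℕ}
    {N : ℕ} {s t : V} (h₁ : p s < q s) (h₂ : q s < p t) (h₃ : p t < q t) (h₄ : q t < N) :
    ¬ Alternate (twoTimeWord p q N) s t := by
  have : (twoTimeWord p q N).filter (fun z => decide (z = s ∨ z = t)) = [s, s, t, t] := by
    rw [filter_twoTimeWord p q N s t [p s, q s, p t, q t]]
    · simp; omega
    all_goals simp
    all_goals omega
  rw [Alternate, this]
  change ¬ List.IsChain _ _
  simp

lemma mem_twoTimeWord {V : Type*} [Fintype V] {p q : V → ℕ} {N : ℕ} {v : V} (h : p v < N) :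
    v ∈ twoTimeWord p q N := by
  simp only [twoTimeWord, List.mem_flatMap, List.mem_range, List.mem_filter]
  exact ⟨p v, h, by simp, by simp⟩

/-- For every edge, oriented by increasing colour, the restriction of `w` to its endpoints `s`, `t`
has the form `stst⋯st`. -/
def RespectsColoring {V : Type*} [DecidableEq V] (G : SimpleGraph V) (c : V → ℕ) (w : List V) :
    Prop :=
  ∀ s t, G.Adj s t → c s < c t →
    ∃ k, w.filter (fun z => decide (z = s ∨ z = t)) = (List.replicate k [s, t]).flatten

lemma RespectsColoring.flatMap {V ι : Type*} [DecidableEq V] {G : SimpleGraph V} {c : V → ℕ}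
    {f : ι → List V} (l : List ι) (hf : ∀ i, RespectsColoring G c (f i)) :
    RespectsColoring G c (l.flatMap f) := by
  intro s t hst hc
  induction l with
  | nil => exact ⟨0, rfl⟩
  | cons a l ih =>
    obtain ⟨k, hk⟩ := ih
    obtain ⟨j, hj⟩ := hf a s t hst hc
    exact ⟨j + k, by rw [List.flatMap_cons, List.filter_append, hj, hk, List.replicate_add,
      List.flatten_append]⟩

lemma RespectsColoring.alternate {V : Type*} [DecidableEq V] {G : SimpleGraph V} {c : V → ℕ}
    {w : List V} (hw : RespectsColoring G c w) {s t : V} (hst : G.Adj s t) (hc : c s < c t) :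
    Alternate w s t := by
  obtain ⟨k, hk⟩ := hw s t hst hc
  rw [Alternate, hk]
  have hne := hst.ne
  clear hk
  change List.IsChain _ _
  induction k with
  | zero => simp
  | succ k ih =>
    rw [List.replicate_succ, List.flatten_cons]
    cases k with
    | zero => simpa using hne
    | succ k =>
      rw [List.replicate_succ, List.flatten_cons] at ih ⊢
      simpa [hne, hne.symm] using ih

lemma RespectsColoring.twoTimeWord {V : Type*} [Fintype V] [DecidableEq V] {G : SimpleGraph V}
    {c p q : V → ℕ} {N : ℕ}
    (h : ∀ s t, G.Adj s t → c s < c t → p s < p t ∧ p t < q s ∧ q s < q t ∧ q t < N) :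
    RespectsColoring G c (twoTimeWord p q N) := by
  intro s t hst hc
  obtain ⟨h₁, h₂, h₃, h₄⟩ := h s t hst hc
  exact ⟨2, filter_twoTimeWord_alternating h₁ h₂ h₃ h₄⟩

lemma exists_respectsColoring_not_alternate {V : Type*} [Fintype V] [DecidableEq V]
    {G : SimpleGraph V} {c : V → ℕ} (hc3 : ∀ v, c v < 3) (u v : V) (huv : ¬ G.Adj u v)
    (hne : u ≠ v) (hc : c u ≤ c v) :
    ∃ w, RespectsColoring G c w ∧ (∀ z, z ∈ w) ∧ ¬ Alternate w u v := by
  have hvu : ¬ G.Adj v u := fun h => huv h.symm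
  have hu3 := hc3 u
  have hv3 := hc3 v
  by_cases hd : c v ≤ c u + 1
  · refine ⟨twoTimeWord (fun z => 4 * c z + if z = v then 1 else 0)
      (fun z => 12 + if z = u then 4 * c u + 2 else if z = v then 4 * c u + 1 else 4 * c z) 30,
      RespectsColoring.twoTimeWord ?_, fun z => mem_twoTimeWord ?_,
      not_alternate_twoTimeWord_nested ?_ ?_ ?_ ?_⟩
    · intro s t hst hlt
      have hs3 := hc3 s
      have ht3 := hc3 t
      clear hc3
      by_cases hsu : s = u <;> by_cases hsv : s = v <;> by_cases htu : t = u <;>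
        by_cases htv : t = v <;> simp_all <;> omega
    · have := hc3 z
      split_ifs <;> omega
    all_goals simp [hne, hne.symm]
    all_goals omega
  · refine ⟨twoTimeWord (fun z => if z = v then 4 else c z)
      (fun z => if z = u then 3 else c z + 5) 10,
      RespectsColoring.twoTimeWord ?_, fun z => mem_twoTimeWord ?_,
      not_alternate_twoTimeWord_disjoint ?_ ?_ ?_ ?_⟩
    · intro s t hst hlt
      have hs3 := hc3 s
      have ht3 := hc3 t
      clear hc3
      by_cases hsu : s = u <;> by_cases hsv : s = v <;> by_cases htu : t = u <;>
        by_cases htv : t = v <;> simp_all <;> omega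
    · have := hc3 z
      split_ifs <;> omega
    all_goals simp [hne, hne.symm]
    all_goals omega

/-- Every finite 3-colourable graph is word-representable. -/
theorem wordRepresentable_of_three_coloring {V : Type*} [Fintype V] [DecidableEq V]
    {G : SimpleGraph V} (c : V → ℕ) (hc3 : ∀ v, c v < 3) (hc : ∀ u v, G.Adj u v → c u ≠ c v) :
    WordRepresentable G := by
  have hex : ∀ e : V × V, ∃ w, RespectsColoring G c w ∧ (∀ z, z ∈ w) ∧
      (¬ G.Adj e.1 e.2 → e.1 ≠ e.2 → ¬ Alternate w e.1 e.2) := by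
    rintro ⟨u, v⟩
    by_cases h : ¬ G.Adj u v ∧ u ≠ v
    · rcases le_total (c u) (c v) with hle | hle
      · obtain ⟨w, h₁, h₂, h₃⟩ := exists_respectsColoring_not_alternate hc3 u v h.1 h.2 hle
        exact ⟨w, h₁, h₂, fun _ _ => h₃⟩
      · obtain ⟨w, h₁, h₂, h₃⟩ := exists_respectsColoring_not_alternate hc3 v u
          (fun h' => h.1 h'.symm) h.2.symm hle
        exact ⟨w, h₁, h₂, fun _ _ => by rwa [alternate_comm]⟩
    · refine ⟨twoTimeWord c (fun z => c z + 3) 6, RespectsColoring.twoTimeWord ?_,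
        fun z => mem_twoTimeWord ?_, fun h₁ h₂ => absurd ⟨h₁, h₂⟩ h⟩
      · intro s t _ _
        have := hc3 s
        have := hc3 t
        omega
      · have := hc3 z
        omega
  choose W hW hmem hnot using hex
  have hgood := RespectsColoring.flatMap (Finset.univ : Finset (V × V)).toList hW
  refine ⟨(Finset.univ : Finset (V × V)).toList.flatMap W,
    fun v => List.mem_flatMap.2 ⟨(v, v), Finset.mem_toList.2 (Finset.mem_univ _), hmem _ v⟩,
    fun u v hne => ⟨?_, ?_⟩⟩
  · intro hadj
    rcases lt_or_gt_of_ne (hc u v hadj) with hlt | hlt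
    · exact hgood.alternate hadj hlt
    · exact (alternate_comm _ _ _).1 (hgood.alternate hadj.symm hlt)
  · intro halt
    by_contra hadj
    refine hnot (u, v) hadj hne ?_
    have hinf : W (u, v) <:+: (Finset.univ : Finset (V × V)).toList.flatMap W :=
      List.infix_of_mem_flatten (List.mem_map_of_mem (by simp))
    obtain ⟨l₁, l₂, hl⟩ := hinf.filter fun z => decide (z = u ∨ z = v)
    rw [Alternate, ← hl] at halt
    exact (List.IsChain.left_of_append halt).right_of_append

theorem stmt7 (n x : ℕ) (hn : 3 ≤ n) (hx1 : 1 < x) (hxn : x < n)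
    (h0 : n % 3 = 0) (h1 : x % 3 = 1) (h2 : 2*x < n) :
    WordRepresentable (SimpleGraph.circulantGraph {((1 : ℕ) : ZMod (2*n)), ((x : ℕ) : ZMod (2*n)), ((n : ℕ) : ZMod (2*n))}) := by
  have : NeZero (2 * n) := ⟨by omega⟩
  let c : ZMod (2 * n) → ℕ := fun i =>
    (i.val + if 3 * i.val < 2 * n then 0 else if 3 * i.val < 4 * n then 1 else 2) % 3
  have hstep : ∀ (u v : ZMod (2 * n)) (s : ℕ), (s = 1 ∨ s = x ∨ s = n) →
      u - v = (s : ZMod (2 * n)) → c u ≠ c v := by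
    intro u v s hs huv
    have hu : u = v + (s : ZMod (2 * n)) := by rw [← huv]; ring
    have hval : u.val = (v.val + s) % (2 * n) := by
      rw [hu, ZMod.val_add, ZMod.val_natCast, Nat.add_mod_mod]
    have hv := ZMod.val_lt v
    have hcases : u.val = v.val + s ∧ v.val + s < 2 * n ∨ u.val + 2 * n = v.val + s := by
      rcases lt_or_ge (v.val + s) (2 * n) with h | h
      · rw [Nat.mod_eq_of_lt h] at hval
        exact Or.inl ⟨hval, h⟩
      · rw [Nat.mod_eq_sub_mod h, Nat.mod_eq_of_lt (by omega)] at hval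
        omega
    simp only [c]
    generalize u.val = a at *
    generalize v.val = b at *
    clear hval
    split_ifs <;> omega
  refine wordRepresentable_of_three_coloring c (fun v => Nat.mod_lt _ (by norm_num)) ?_
  intro u v hadj
  rw [SimpleGraph.circulantGraph_adj] at hadj
  simp only [Set.mem_insert_iff, Set.mem_singleton_iff] at hadj
  rcases hadj.2 with (h | h | h) | (h | h | h)
  · exact hstep u v 1 (by simp) h
  · exact hstep u v x (by simp) h
  · exact hstep u v n (by simp) h
  · exact (hstep v u 1 (by simp) h).symm
  · exact (hstep v u x (by simp) h).symm
  · exact (hstep v u n (by simp) h).symm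
end
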